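/- Let α ≥ 2 be a countable ordinal. If L ⊆ Σ^ω is Π⁰_α-complete, then h(L) ∪ (Γ^ω − h(Σ^ω)) is a Π⁰_α-complete subset of Γ^ω. -/

import Mathlib

universe u

/-- We equip `Option σ` (the alphabet `Γ = Σ ∪ {A}`, with `A = none`) with the
discrete topology. -/
instance instTopOption (σ : Type u) : TopologicalSpace (Option σ) := ⊥
instance instDiscreteOption (σ : Type u) : DiscreteTopology (Option σ) := ⟨rfl⟩

/-- Auxiliary function for the coding map `h`: reads position `i` inside the
concatenation of the blocks `A·0^(n+1)·x(n), A·0^(n+2)·x(n+1), ...`. -/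
def hAux {σ : Type u} (z : σ) (x : ℕ → σ) : ℕ → ℕ → Option σ
  | _, 0 => none
  | n, (i+1) =>
    if i + 1 ≤ n + 1 then some z
    else if i + 1 = n + 2 then some (x n)
    else hAux z x (n+1) (i + 1 - (n+3))
  termination_by n i => i
  decreasing_by omega

/-- The coding map `h : Σ^ω → Γ^ω`,
`h(x) = A·0·x(1)·A·0²·x(2)·A·0³·x(3)···A·0ⁿ·x(n)···` (ω-words indexed by `ℕ`). -/
def hmap {σ : Type u} (z : σ) (x : ℕ → σ) : ℕ → Option σ := fun i => hAux z x 0 i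

/-- Auxiliary function for the ω-word `α₀`. -/
def aAux {σ : Type u} (z : σ) : ℕ → ℕ → Option σ
  | _, 0 => none
  | n, (i+1) =>
    if i + 1 ≤ n + 1 then some z
    else aAux z (n+1) (i + 1 - (n+2))
  termination_by n i => i
  decreasing_by omega

/-- The ω-word `α₀ = A·0·A·0²·A·0³···A·0ⁿ···` over `Γ = Σ ∪ {A}`. -/
def alphaWord {σ : Type u} (z : σ) : ℕ → Option σ := fun i => aAux z 0 i

/-- The Borel hierarchy on a topological space `X`: `SigmaPi X α true` is the class
`Σ⁰_α` and `SigmaPi X α false` is the class `Π⁰_α`.  `Σ⁰_1` is the class of open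
sets, `Π⁰_1` is the class of closed sets, and for `α ≥ 2`, `Σ⁰_α` (resp. `Π⁰_α`)
is the class of countable unions (resp. intersections) of sets in
`⋃_{γ < α} Π⁰_γ` (resp. `⋃_{γ < α} Σ⁰_γ`). -/
def SigmaPi (X : Type u) [TopologicalSpace X] (α : Ordinal.{0}) (b : Bool) : Set (Set X) :=
  {s | (α = 1 ∧ ((b = true ∧ IsOpen s) ∨ (b = false ∧ IsClosed s)))
    ∨ (α ≠ 1 ∧ ∃ f : ℕ → Set X,
        (∀ n : ℕ, ∃ γ : Ordinal.{0}, ∃ _ : γ < α, f n ∈ SigmaPi X γ !b) ∧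
        s = if b then ⋃ n, f n else ⋂ n, f n)}
  termination_by α
  decreasing_by assumption

/-- The class `Σ⁰_α` of the Borel hierarchy on `X`. -/
abbrev Sigma0 (X : Type u) [TopologicalSpace X] (α : Ordinal.{0}) : Set (Set X) :=
  SigmaPi X α true

/-- The class `Π⁰_α` of the Borel hierarchy on `X`. -/
abbrev Pi0 (X : Type u) [TopologicalSpace X] (α : Ordinal.{0}) : Set (Set X) :=
  SigmaPi X α false

/-- `F ⊆ Σ^ω` is `Σ⁰_α`-complete (for `b = true`), resp. `Π⁰_α`-complete (for
`b = false`), iff for every nonempty finite alphabet `Y` and every `E ⊆ Y^ω`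
(with `Y^ω` carrying the Cantor topology, i.e. the product of the discrete
topology): `E ∈ Σ⁰_α` (resp. `Π⁰_α`) iff `E = f⁻¹(F)` for some continuous
`f : Y^ω → Σ^ω`. -/
def IsCompleteFor (b : Bool) (α : Ordinal.{0}) {σ : Type} [TopologicalSpace σ]
    (F : Set (ℕ → σ)) : Prop :=
  ∀ (Y : Type), Fintype Y → Nonempty Y → ∀ E : Set (ℕ → Y),
    letI : TopologicalSpace Y := ⊥
    (E ∈ SigmaPi (ℕ → Y) α b ↔
      ∃ f : (ℕ → Y) → (ℕ → σ), Continuous f ∧ E = f ⁻¹' F)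

/-- The infinite concatenation of the finite words `u 0, u 1, u 2, ...` equals the
ω-word `x`: every finite partial concatenation is a prefix of `x`, and the total
length is infinite. -/
def JoinsTo {α : Type u} (u : ℕ → List α) (x : ℕ → α) : Prop :=
  (∀ N : ℕ, ∃ n : ℕ, N ≤ (((List.range n).map u).flatten).length) ∧
  (∀ (n i : ℕ) (h : i < (((List.range n).map u).flatten).length),
      (((List.range n).map u).flatten)[i]'h = x i)

/-- A 2-tape Büchi automaton with input alphabet `σ` and output alphabet `γ`:
a finite set of states `Q`, a finite set `trans ⊆ Q × σ^⋆ × γ^⋆ × Q` of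
transitions, an initial state `init` and a set `acc` of accepting states. -/
structure TwoTapeBuchi (σ γ : Type u) where
  Q : Type u
  finQ : Finite Q
  trans : Set (Q × List σ × List γ × Q)
  finTrans : trans.Finite
  init : Q
  acc : Set Q

/-- The pair `(x, y)` of ω-words is accepted by the 2-tape Büchi automaton `T`
iff it is the pair of input and output words of some successful computation. -/
def TwoTapeBuchi.Accepts {σ γ : Type u} (T : TwoTapeBuchi σ γ)
    (x : ℕ → σ) (y : ℕ → γ) : Prop :=
  ∃ (q : ℕ → T.Q) (u : ℕ → List σ) (v : ℕ → List γ),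
    q 0 = T.init ∧
    (∀ n : ℕ, (q n, u n, v n, q (n+1)) ∈ T.trans) ∧
    (∃ qf ∈ T.acc, ∀ n : ℕ, ∃ m : ℕ, n ≤ m ∧ q m = qf) ∧
    JoinsTo u x ∧ JoinsTo v y

/-- `R ⊆ Σ^ω × Γ^ω` is an infinitary rational relation iff it is the relation
accepted by some 2-tape Büchi automaton. -/
def IsRatRel {σ γ : Type u} (R : Set ((ℕ → σ) × (ℕ → γ))) : Prop :=
  ∃ T : TwoTapeBuchi σ γ, ∀ p : (ℕ → σ) × (ℕ → γ), p ∈ R ↔ T.Accepts p.1 p.2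

/-- A real-time Büchi 1-counter automaton: transitions are in
`Q × σ × Bool × Q × ℤ` with the counter move in `{-1, 0, 1}`, and a zero test
(`false` means the counter is zero) which forbids decrementing a zero counter. -/
structure OneCounterBuchi (σ : Type u) where
  Q : Type u
  finQ : Finite Q
  trans : Set (Q × σ × Bool × Q × ℤ)
  transMoves : ∀ t ∈ trans, t.2.2.2.2 = -1 ∨ t.2.2.2.2 = 0 ∨ t.2.2.2.2 = 1
  transZero : ∀ t ∈ trans, t.2.2.1 = false → t.2.2.2.2 = 0 ∨ t.2.2.2.2 = 1
  init : Q
  acc : Set Q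

/-- One computation step of a 1-counter automaton on letter `a`, from
configuration `p` to configuration `p'`. -/
def OneCounterBuchi.Step {σ : Type u} (M : OneCounterBuchi σ) (a : σ)
    (p p' : M.Q × ℕ) : Prop :=
  ∃ j : ℤ, (p.1, a, (p.2 ≠ 0 : Bool), p'.1, j) ∈ M.trans ∧ (p'.2 : ℤ) = (p.2 : ℤ) + j

/-- The ω-word `x` is accepted by the real-time Büchi 1-counter automaton `M`:
there is a run on `x` starting in `(q₀, 0)` in which some accepting state occurs
infinitely often. -/
def OneCounterBuchi.Accepts {σ : Type u} (M : OneCounterBuchi σ) (x : ℕ → σ) : Prop :=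
  ∃ r : ℕ → M.Q × ℕ,
    r 0 = (M.init, 0) ∧
    (∀ i : ℕ, M.Step (x i) (r i) (r (i+1))) ∧
    ∃ qf ∈ M.acc, ∀ n : ℕ, ∃ m : ℕ, n ≤ m ∧ (r m).1 = qf

/-- The identification of a pair of ω-words with an ω-word over the product
alphabet. -/
def pairToWord {a b : Type u} (p : (ℕ → a) × (ℕ → b)) : ℕ → a × b :=
  fun n => (p.1 n, p.2 n)
theorem hAux_shift {σ : Type u} (z : σ) (x : ℕ → σ) (n i : ℕ) :
    hAux z x n (n + 3 + i) = hAux z x (n + 1) i := by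
  have e : n + 3 + i = (n + 2 + i) + 1 := by omega
  rw [e, hAux, if_neg (by omega), if_neg (by omega)]
  congr 1
  omega

theorem hAux_pos {σ : Type u} (z : σ) (k : ℕ) :
    ∀ m : ℕ, ∃ p : ℕ, ∀ x : ℕ → σ, hAux z x m p = some (x (m + k)) := by
  induction k with
  | zero =>
    intro m
    refine ⟨m + 1 + 1, fun x => ?_⟩
    rw [hAux, if_neg (by omega), if_pos (by omega)]
    simp
  | succ k ih =>
    intro m
    obtain ⟨p, hp⟩ := ih (m + 1)
    refine ⟨m + 3 + p, fun x => ?_⟩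
    rw [hAux_shift, hp]
    congr 2
    omega

theorem hAux_continuous {σ : Type u} [TopologicalSpace σ] [DiscreteTopology σ] (z : σ) (i : ℕ) :
    ∀ n : ℕ, Continuous (fun x : ℕ → σ => hAux z x n i) := by
  induction i using Nat.strong_induction_on with
  | _ i ih =>
    intro n
    cases i with
    | zero => simp only [hAux]; exact continuous_const
    | succ i =>
      simp only [hAux]
      split_ifs
      · exact continuous_const
      · exact (continuous_of_discreteTopology (f := fun a : σ => some a)).comp
          (continuous_apply n)
      · exact ih _ (by omega) _

theorem hmap_continuous {σ : Type u} [TopologicalSpace σ] [DiscreteTopology σ] (z : σ) :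
    Continuous (hmap z) :=
  continuous_pi fun i => hAux_continuous z i 0

theorem exists_decoder {σ : Type u} [TopologicalSpace σ] [DiscreteTopology σ] (z : σ) :
    ∃ d : (ℕ → Option σ) → (ℕ → σ), Continuous d ∧ ∀ x, d (hmap z x) = x := by
  choose p hp using fun k => hAux_pos z k 0
  refine ⟨fun y n => (y (p n)).getD z, continuous_pi fun n => ?_, fun x => ?_⟩
  · exact (continuous_of_discreteTopology (f := fun a : Option σ => a.getD z)).comp
      (continuous_apply (p n))
  · funext n
    simp [hmap, hp]

/-- Adding a countable union of clopen sets keeps a set in `Σ⁰_γ`. -/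
theorem sigma0_union {X : Type u} [TopologicalSpace X] (γ : Ordinal.{0}) (A : Set X)
    (hA : A ∈ SigmaPi X γ true) (C : ℕ → Set X) (hC : ∀ n, IsClopen (C n)) :
    A ∪ (⋃ n, C n) ∈ SigmaPi X γ true := by
  rw [SigmaPi] at hA ⊢
  rcases hA with ⟨h1, hA⟩ | ⟨h1, f, hf, hA⟩
  · left
    refine ⟨h1, Or.inl ⟨rfl, ?_⟩⟩
    rcases hA with ⟨_, hA⟩ | ⟨hb, _⟩
    · exact hA.union (isOpen_iUnion fun n => (hC n).isOpen)
    · cases hb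
  · right
    obtain ⟨γ0, hγ0, _⟩ := hf 0
    have hlt : (1 : Ordinal.{0}) < γ := by
      refine lt_of_le_of_ne ?_ (Ne.symm h1)
      exact Order.one_le_iff_pos.2 (lt_of_le_of_lt (zero_le) hγ0)
    refine ⟨h1, fun n => if n % 2 = 0 then f (n / 2) else C (n / 2), fun n => ?_, ?_⟩
    · by_cases hn : n % 2 = 0
      · simp only [hn, if_true]
        exact hf (n / 2)
      · simp only [hn, if_false]
        refine ⟨1, hlt, ?_⟩
        rw [SigmaPi]
        exact Or.inl ⟨rfl, Or.inr ⟨rfl, (hC _).isClosed⟩⟩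
    · rw [hA]
      simp only [if_true]
      ext y
      simp only [Set.mem_union, Set.mem_iUnion]
      constructor
      · rintro (⟨n, h⟩ | ⟨n, h⟩)
        · refine ⟨2 * n, ?_⟩
          have e1 : 2 * n % 2 = 0 := by omega
          have e2 : 2 * n / 2 = n := by omega
          rw [if_pos e1, e2]; exact h
        · refine ⟨2 * n + 1, ?_⟩
          have e1 : ¬ (2 * n + 1) % 2 = 0 := by omega
          have e2 : (2 * n + 1) / 2 = n := by omega
          rw [if_neg e1, e2]; exact h
      · rintro ⟨n, h⟩
        split_ifs at h
        · exact Or.inl ⟨_, h⟩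
        · exact Or.inr ⟨_, h⟩

theorem pi0_union {X : Type u} [TopologicalSpace X] (α : Ordinal.{0}) (hα : 2 ≤ α) (A : Set X)
    (hA : A ∈ SigmaPi X α false) (C : ℕ → Set X) (hC : ∀ n, IsClopen (C n)) :
    A ∪ (⋃ n, C n) ∈ SigmaPi X α false := by
  have hne : α ≠ 1 := by
    rintro rfl
    exact absurd hα (not_le.2 (by exact_mod_cast (Nat.one_lt_two)))
  rw [SigmaPi] at hA ⊢
  rcases hA with ⟨h1, _⟩ | ⟨_, f, hf, hA⟩
  · exact absurd h1 hne
  · right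
    refine ⟨hne, fun n => f n ∪ ⋃ n, C n, fun n => ?_, ?_⟩
    · obtain ⟨γ, hγ, h⟩ := hf n
      exact ⟨γ, hγ, sigma0_union γ _ h C hC⟩
    · rw [hA]
      simp [Set.iInter_union]

/-- For a countable ordinal `α ≥ 2`, if `L ⊆ Σ^ω` is
`Π⁰_α`-complete then `h(L) ∪ (Γ^ω − h(Σ^ω))` is a `Π⁰_α`-complete subset of
`Γ^ω`. -/
theorem hmap_image_union_compl_piComplete (σ : Type) [Fintype σ] [Nonempty σ]
    [TopologicalSpace σ] [DiscreteTopology σ] (z : σ)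
    (α : Ordinal.{0}) (hα : 2 ≤ α) (hcount : α.card ≤ Cardinal.aleph0)
    (L : Set (ℕ → σ)) (hL : IsCompleteFor false α L) :
    IsCompleteFor false α (hmap z '' L ∪ (Set.range (hmap z))ᶜ) := by
  obtain ⟨d, hd, hdh⟩ := exists_decoder z
  have hinj : Function.Injective (hmap z) := Function.LeftInverse.injective hdh
  intro Y hY hne E
  have key := hL Y hY hne E
  letI : TopologicalSpace Y := ⊥
  haveI : DiscreteTopology Y := ⟨rfl⟩
  constructor
  · intro hE
    obtain ⟨f, hf, rfl⟩ := key.1 hE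
    refine ⟨fun y => hmap z (f y), (hmap_continuous z).comp hf, ?_⟩
    ext y
    simp [hinj.eq_iff]
  · rintro ⟨f, hf, rfl⟩
    have h1 : (fun y => d (f y)) ⁻¹' L ∈ SigmaPi (ℕ → Y) α false :=
      (hL Y hY hne _).2 ⟨_, hd.comp hf, rfl⟩
    have h2 := pi0_union α hα _ h1
      (fun n => {y | hmap z (d (f y)) n ≠ f y n}) (fun n => by
        have c1 : Continuous fun y => (hmap z (d (f y)) n, f y n) :=
          ((continuous_apply n).comp ((hmap_continuous z).comp (hd.comp hf))).prodMk
            ((continuous_apply n).comp hf)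
        exact (isClopen_discrete {p : Option σ × Option σ | p.1 ≠ p.2}).preimage c1)
    convert h2 using 1
    ext y
    simp only [Set.mem_preimage, Set.mem_union, Set.mem_compl_iff, Set.mem_iUnion,
      Set.mem_setOf_eq]
    by_cases hy : hmap z (d (f y)) = f y
    · have hr : f y ∈ Set.range (hmap z) := ⟨_, hy⟩
      have hn : ¬ ∃ i, hmap z (d (f y)) i ≠ f y i := by simp [hy]
      simp only [hr, hn, not_true_eq_false, or_false]
      constructor
      · rintro ⟨x, hx, e⟩
        rw [← e, hdh]; exact hx
      · intro h
        exact ⟨_, h, hy⟩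
    · have hr : ¬ f y ∈ Set.range (hmap z) := by
        rintro ⟨x, e⟩
        apply hy
        rw [← e, hdh]
      have hn : ∃ i, hmap z (d (f y)) i ≠ f y i := Function.ne_iff.1 hy
      exact ⟨fun _ => Or.inr hn, fun _ => Or.inr hr⟩
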